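/- arXiv:math/9504215 — 2 statements merged into one kernel-verified Lean document; each statement's English description precedes it below -/
import Mathlib

section
/- Let α ≥ 0 be a real number. Then for every f ∈ L_{w(α)}, the Fourier–Laguerre coefficients f̂_α(k) = ∫_0^∞ f(x) R_k^α(x) x^α e^{-x} dx exist (the integrals converge absolutely) and satisfy lim_{k→∞} f̂_α(k) = 0. -/
open MeasureTheory Filter Set

noncomputable section

/-- Generalized binomial coefficient `C(a, m) = Γ(a+1)/(Γ(m+1)Γ(a-m+1))`. -/
def genBinom (a : ℝ) (m : ℕ) : ℝ :=
  Real.Gamma (a + 1) / (Real.Gamma ((m : ℝ) + 1) * Real.Gamma (a - (m : ℝ) + 1))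

/-- The Laguerre polynomial `L_k^α(x) = Σ_{j=0}^k (-1)^j C(k+α, k-j) x^j / j!`. -/
def laguerreL (α : ℝ) (k : ℕ) (x : ℝ) : ℝ :=
  ∑ j ∈ Finset.range (k + 1),
    (-1 : ℝ) ^ j * genBinom ((k : ℝ) + α) (k - j) * x ^ j / (Nat.factorial j : ℝ)

/-- The normalized Laguerre polynomial `R_k^α(x) = L_k^α(x)/L_k^α(0)`,
with `L_k^α(0) = C(k+α, k)`. -/
def laguerreR (α : ℝ) (k : ℕ) (x : ℝ) : ℝ := laguerreL α k x / genBinom ((k : ℝ) + α) k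

/-- `f ∈ L_{w(α)}`: `∫_0^∞ |f(x)| e^{-x/2} x^α dx < ∞`. -/
def MemLaguerreL (α : ℝ) (f : ℝ → ℝ) : Prop :=
  IntegrableOn (fun x => f x * Real.exp (-x / 2) * x ^ α) (Ioi 0)

end

/-- The Charlier polynomials `x ^ k * C_k(m; x)` at natural arguments, defined by the raising
recurrence. -/
def charlier (x : ℝ) : ℕ → ℕ → ℝ
  | 0, _ => 1
  | k + 1, m => x * charlier x k m - m * charlier x k (m - 1)

theorem charlier_zero (x : ℝ) (m : ℕ) : charlier x 0 m = 1 := by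
  simp [charlier]

theorem charlier_succ (x : ℝ) (k m : ℕ) :
    charlier x (k + 1) m = x * charlier x k m - m * charlier x k (m - 1) := by
  simp [charlier]

theorem charlier_succ_succ (x : ℝ) (k m : ℕ) :
    charlier x (k + 1) (m + 1) = charlier x (k + 1) m - (k + 1) * charlier x k m := by
  induction k generalizing m with
  | zero => simp [charlier]; ring
  | succ k ih =>
    rw [charlier_succ x (k + 1) (m + 1), charlier_succ x (k + 1) m, Nat.add_sub_cancel, ih m]
    cases m with
    | zero => rw [charlier_succ x k 0]; push_cast; ring
    | succ m =>
      rw [Nat.add_sub_cancel]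
      have h1 := ih m
      have h2 := charlier_succ x k (m + 1)
      rw [Nat.add_sub_cancel] at h2
      push_cast at h2 ⊢
      linear_combination (-(m : ℝ) - 1) * h1 + (k + 1) * h2

theorem charlier_three_term (x : ℝ) (k m : ℕ) :
    x * charlier x k (m + 2) =
      (x + m + 1 - k) * charlier x k (m + 1) - (m + 1) * charlier x k m := by
  cases k with
  | zero => simp [charlier_zero]
  | succ k =>
    have h1 := charlier_succ_succ x k (m + 1)
    have h2 := charlier_succ x k (m + 1)
    have h3 := charlier_succ_succ x k m
    rw [Nat.add_sub_cancel] at h2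
    push_cast at h2 ⊢
    linear_combination x * h1 + (k + 1) * h2 - (m + 1) * h3

theorem abs_charlier_le {x : ℝ} (hx : 0 ≤ x) (k m : ℕ) : |charlier x k m| ≤ (x + m) ^ k := by
  induction k generalizing m with
  | zero => simp [charlier_zero]
  | succ k ih =>
    have h : |charlier x k (m - 1)| ≤ (x + m) ^ k :=
      (ih (m - 1)).trans (by gcongr; exact Nat.sub_le m 1)
    calc |charlier x (k + 1) m|
        ≤ |x * charlier x k m| + |m * charlier x k (m - 1)| := by
          rw [charlier_succ]; exact abs_sub _ _
      _ = x * |charlier x k m| + m * |charlier x k (m - 1)| := by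
          rw [abs_mul, abs_mul, abs_of_nonneg hx, Nat.abs_cast]
      _ ≤ x * (x + m) ^ k + m * (x + m) ^ k := by gcongr; exact ih m
      _ = (x + m) ^ (k + 1) := by ring

theorem summable_charlier_mul {x : ℝ} (hx : 0 ≤ x) (k l : ℕ) :
    Summable fun m : ℕ => x ^ m / m.factorial * (charlier x k m * charlier x l m) := by
  have hs := (Real.summable_pow_div_factorial (x * Real.exp 1)).mul_left
    ((k + l).factorial * Real.exp x)
  refine Summable.of_norm_bounded hs fun m => ?_
  have hexp : (x + m) ^ (k + l) ≤ (k + l).factorial * Real.exp (x + m) := by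
    have := Real.pow_div_factorial_le_exp (x + m) (by positivity) (k + l)
    rwa [div_le_iff₀' (by positivity)] at this
  rw [Real.norm_eq_abs, abs_mul, abs_mul, abs_of_nonneg (by positivity : 0 ≤ x ^ m / m.factorial)]
  calc x ^ m / m.factorial * (|charlier x k m| * |charlier x l m|)
      ≤ x ^ m / m.factorial * ((x + m) ^ k * (x + m) ^ l) := by
        gcongr <;> exact abs_charlier_le hx _ _
    _ ≤ x ^ m / m.factorial * ((k + l).factorial * Real.exp (x + m)) := by
        rw [← pow_add]; gcongr
    _ = _ := by
        rw [Real.exp_add, mul_pow, ← Real.exp_nat_mul, mul_one]; ring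

theorem hasSum_charlier_sq {x : ℝ} (hx : 0 ≤ x) (k : ℕ) :
    HasSum (fun m : ℕ => x ^ m / m.factorial * charlier x k m ^ 2)
      (x ^ k * k.factorial * Real.exp x) := by
  induction k with
  | zero =>
    simp only [charlier_zero, one_pow, mul_one, pow_zero, Nat.factorial_zero, Nat.cast_one]
    rw [one_mul, Real.exp_eq_exp_ℝ]
    exact NormedSpace.expSeries_div_hasSum_exp x
  | succ k ih =>
    obtain ⟨a, ha⟩ := summable_charlier_mul hx k (k + 1)
    have h1 := (ha.mul_left x).sub (ih.mul_left (x * (k + 1)))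
    have h2 : HasSum (fun m : ℕ => x ^ m / m.factorial *
        (m * charlier x k (m - 1) * charlier x (k + 1) m))
        (x * a - x * (k + 1) * (x ^ k * k.factorial * Real.exp x)) := by
      rw [← hasSum_nat_add_iff' 1]
      simp only [Finset.range_one, Finset.sum_singleton, Nat.cast_zero, zero_mul, mul_zero,
        sub_zero]
      refine h1.congr_fun fun m => ?_
      rw [Nat.add_sub_cancel, charlier_succ_succ, Nat.factorial_succ]
      push_cast
      field_simp
      ring
    have h3 := (ha.mul_left x).sub h2
    have hval : x ^ (k + 1) * (k + 1).factorial * Real.exp x =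
        x * a - (x * a - x * (k + 1) * (x ^ k * k.factorial * Real.exp x)) := by
      rw [Nat.factorial_succ]; push_cast; ring
    rw [hval]
    refine h3.congr_fun fun m => ?_
    linear_combination x ^ m / m.factorial * charlier x (k + 1) m * charlier_succ x k m

theorem charlier_eq_sum (x : ℝ) (k m : ℕ) :
    charlier x k m =
      ∑ j ∈ Finset.range (k + 1), (-1) ^ j * k.choose j * m.descFactorial j * x ^ (k - j) := by
  induction k generalizing m with
  | zero => simp [charlier_zero]
  | succ k ih =>
    have hd : ∀ j : ℕ, (m : ℝ) * (m - 1).descFactorial j = m.descFactorial (j + 1) := by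
      intro j
      cases m with
      | zero => simp
      | succ m => rw [Nat.succ_descFactorial_succ]; push_cast; simp
    rw [charlier_succ, ih, ih, Finset.sum_range_succ' _ (k + 1), Finset.mul_sum, Finset.mul_sum]
    have h1 : ∑ j ∈ Finset.range (k + 1),
        x * ((-1) ^ j * k.choose j * m.descFactorial j * x ^ (k - j)) =
        ∑ j ∈ Finset.range (k + 1),
          (-1) ^ (j + 1) * k.choose (j + 1) * m.descFactorial (j + 1) * x ^ (k - j)
        + x ^ (k + 1) := by
      rw [Finset.sum_range_succ', Finset.sum_range_succ]
      simp only [Nat.choose_succ_self, Nat.cast_zero, mul_zero, zero_mul, add_zero]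
      congr 1
      · refine Finset.sum_congr rfl fun j hj => ?_
        rw [Finset.mem_range] at hj
        rw [show k - j = (k - (j + 1)) + 1 by omega]
        ring
      · simp; ring
    rw [h1, add_sub_right_comm, ← Finset.sum_sub_distrib]
    congr 1
    · refine Finset.sum_congr rfl fun j _ => ?_
      rw [Nat.choose_succ_succ, Nat.add_sub_add_right, ← hd]
      push_cast
      ring
    · simp

/-- The multiset coefficient `a (a + 1) ⋯ (a + n - 1) / n!` of a real number `a`. -/
noncomputable def realMultichoose (a : ℝ) (n : ℕ) : ℝ := ∏ t ∈ Finset.range n, (a + t) / (t + 1)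

theorem realMultichoose_succ (a : ℝ) (n : ℕ) :
    realMultichoose a (n + 1) = realMultichoose a n * ((a + n) / (n + 1)) :=
  Finset.prod_range_succ _ _

theorem realMultichoose_nonneg {a : ℝ} (ha : 0 ≤ a) (n : ℕ) : 0 ≤ realMultichoose a n :=
  Finset.prod_nonneg fun _ _ => by positivity

theorem realMultichoose_pos {a : ℝ} (ha : 0 < a) (n : ℕ) : 0 < realMultichoose a n :=
  Finset.prod_pos fun _ _ => by positivity

theorem add_mul_realMultichoose (a : ℝ) (n : ℕ) :
    (a + n) * realMultichoose a n = a * realMultichoose (a + 1) n := by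
  induction n with
  | zero => simp [realMultichoose]
  | succ n ih =>
    rw [realMultichoose_succ, realMultichoose_succ]
    push_cast
    linear_combination (a + (n + 1)) / (n + 1) * ih

theorem realMultichoose_pascal (a : ℝ) (n : ℕ) :
    realMultichoose (a + 1) (n + 1) = realMultichoose (a + 1) n + realMultichoose a (n + 1) := by
  have h := add_mul_realMultichoose a n
  rw [realMultichoose_succ, realMultichoose_succ]
  have hn : (n : ℝ) + 1 ≠ 0 := by positivity
  field_simp
  linear_combination -h

theorem realMultichoose_mono {a : ℝ} (ha : 0 ≤ a) : Monotone (realMultichoose (a + 1)) := by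
  refine monotone_nat_of_le_succ fun n => ?_
  rw [realMultichoose_pascal]
  exact le_add_of_nonneg_right (realMultichoose_nonneg ha _)

/-- A form of the Chu–Vandermonde identity. -/
theorem sum_realMultichoose_mul_choose (a : ℝ) (k j : ℕ) :
    ∑ i ∈ Finset.range (k + 1), realMultichoose a (k - i) * i.choose j =
      if j ≤ k then realMultichoose (a + j + 1) (k - j) else 0 := by
  induction k generalizing j with
  | zero => cases j <;> simp [realMultichoose]
  | succ k ih =>
    cases j with
    | zero =>
      have h := ih 0
      simp only [Nat.choose_zero_right, Nat.cast_one, mul_one, zero_le, if_true, Nat.cast_zero,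
        add_zero, Nat.sub_zero] at h ⊢
      rw [Finset.sum_range_succ']
      simp only [Nat.add_sub_add_right, h, Nat.sub_zero]
      rw [realMultichoose_pascal]
    | succ j =>
      rw [Finset.sum_range_succ']
      simp only [Nat.add_sub_add_right, Nat.choose_zero_succ, Nat.cast_zero, mul_zero, add_zero,
        Nat.choose_succ_succ, Nat.cast_add, mul_add, Finset.sum_add_distrib, ih,
        Nat.add_le_add_iff_right]
      rcases lt_trichotomy j k with h | h | h
      · obtain ⟨d, rfl⟩ := Nat.exists_eq_add_of_lt h
        rw [if_pos (by omega), if_pos (by omega), if_pos (by omega),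
          show j + d + 1 - j = d + 1 by omega, show j + d + 1 - (j + 1) = d by omega]
        push_cast
        rw [show a + (j + 1) + 1 = (a + j + 1) + 1 by ring, realMultichoose_pascal (a + j + 1)]
        ring
      · subst h
        simp [realMultichoose]
      · rw [if_neg (by omega), if_neg (by omega), if_neg (by omega), add_zero]

theorem Gamma_add_nat_eq_realMultichoose {a : ℝ} (ha : 0 < a) (n : ℕ) :
    Real.Gamma (a + n) = realMultichoose a n * n.factorial * Real.Gamma a := by
  induction n with
  | zero => simp [realMultichoose]
  | succ n ih =>
    push_cast
    rw [← add_assoc, Real.Gamma_add_one (by positivity), ih, realMultichoose_succ,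
      Nat.factorial_succ]
    push_cast
    field_simp

theorem genBinom_eq_realMultichoose {α : ℝ} (hα : 0 ≤ α) {k j : ℕ} (h : j ≤ k) :
    genBinom (k + α) (k - j) = realMultichoose (α + j + 1) (k - j) := by
  obtain ⟨n, rfl⟩ := Nat.exists_eq_add_of_le h
  have hG := Gamma_add_nat_eq_realMultichoose (a := α + j + 1) (by positivity) n
  have hp : 0 < Real.Gamma (α + j + 1) := Real.Gamma_pos_of_pos (by positivity)
  rw [genBinom, Nat.add_sub_cancel_left, Real.Gamma_nat_eq_factorial]
  push_cast
  rw [show (j : ℝ) + n + α + 1 = α + j + 1 + n by ring,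
    show (j : ℝ) + n + α - n + 1 = α + j + 1 by ring, hG]
  field_simp

theorem genBinom_self_eq_realMultichoose {α : ℝ} (hα : 0 ≤ α) (k : ℕ) :
    genBinom (k + α) k = realMultichoose (α + 1) k := by
  simpa using genBinom_eq_realMultichoose hα (Nat.zero_le k)

theorem laguerreL_zero_eq_sum (k : ℕ) (x : ℝ) {n : ℕ} (h : k ≤ n) :
    laguerreL 0 k x =
      ∑ j ∈ Finset.range (n + 1), k.choose j * ((-1) ^ j * x ^ j / j.factorial) := by
  have hsub : Finset.range (k + 1) ⊆ Finset.range (n + 1) := by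
    intro j; simp only [Finset.mem_range]; omega
  rw [laguerreL, ← Finset.sum_subset hsub fun j _ hj => by
    rw [Nat.choose_eq_zero_of_lt (by simpa using hj)]; simp]
  refine Finset.sum_congr rfl fun j hj => ?_
  have hj' : j ≤ k := by simpa [Nat.lt_succ_iff] using hj
  have hc := sum_realMultichoose_mul_choose 0 k j
  rw [if_pos hj', Finset.sum_range_succ, Finset.sum_eq_zero, Nat.sub_self] at hc
  · rw [genBinom_eq_realMultichoose le_rfl hj', ← hc]
    simp [realMultichoose]
    ring
  · intro i hi
    have hi' : k - i ≠ 0 := by have := Finset.mem_range.mp hi; omega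
    obtain ⟨d, hd⟩ := Nat.exists_eq_succ_of_ne_zero hi'
    rw [hd, realMultichoose, Finset.prod_range_succ']
    simp

theorem laguerreL_eq_sum_laguerreL_zero {α : ℝ} (hα : 0 ≤ α) (k : ℕ) (x : ℝ) :
    laguerreL α k x =
      ∑ i ∈ Finset.range (k + 1), realMultichoose α (k - i) * laguerreL 0 i x := by
  calc laguerreL α k x
      = ∑ j ∈ Finset.range (k + 1), (∑ i ∈ Finset.range (k + 1),
          realMultichoose α (k - i) * i.choose j) * ((-1) ^ j * x ^ j / j.factorial) := by
        refine Finset.sum_congr rfl fun j hj => ?_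
        have hj' : j ≤ k := by simpa [Nat.lt_succ_iff] using hj
        rw [sum_realMultichoose_mul_choose, if_pos hj', genBinom_eq_realMultichoose hα hj']
        ring
    _ = _ := by
        simp only [Finset.sum_mul]
        rw [Finset.sum_comm]
        refine Finset.sum_congr rfl fun i hi => ?_
        have hi' : i ≤ k := by simpa [Nat.lt_succ_iff] using hi
        rw [laguerreL_zero_eq_sum i x hi', Finset.mul_sum]
        simp only [mul_assoc]

theorem laguerreL_zero_eq_charlier (k : ℕ) (x : ℝ) :
    laguerreL 0 k x = (-1) ^ k * charlier x k k / k.factorial := by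
  rw [laguerreL_zero_eq_sum k x le_rfl, charlier_eq_sum, ← Finset.sum_range_reflect,
    Finset.mul_sum, Finset.sum_div]
  refine Finset.sum_congr rfl fun j hj => ?_
  obtain ⟨d, rfl⟩ := Nat.exists_eq_add_of_le (Nat.lt_succ_iff.mp (Finset.mem_range.mp hj))
  have hc : (j + d).choose j = (j + d).choose d := Nat.choose_symm_add
  have hd : (d.factorial : ℝ) * (j + d).descFactorial j = (j + d).factorial := by
    have := Nat.factorial_mul_descFactorial (Nat.le_add_right j d)
    rw [Nat.add_sub_cancel_left] at this
    exact_mod_cast this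
  rw [show j + d + 1 - 1 - j = d by omega, hc, ← hd, pow_add]
  have hp : (0 : ℝ) < (j + d).descFactorial j := by
    have := Nat.descFactorial_pos.mpr (Nat.le_add_right j d)
    exact_mod_cast this
  have hsq : ((-1 : ℝ) ^ j) * (-1) ^ j = 1 := by rw [← mul_pow]; simp
  rw [show j + d - j = d by omega]
  field_simp
  linear_combination -((j + d).choose d * x ^ d) * hsq

/-- The Charlier polynomials normalized to an orthonormal system, with the square root of the
Poisson weight absorbed. -/
noncomputable def charlierUnit (x : ℝ) (k m : ℕ) : ℝ :=
  charlier x k m * √(x ^ m / m.factorial) / √(x ^ k * k.factorial * Real.exp x)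

theorem charlierUnit_sq {x : ℝ} (hx : 0 ≤ x) (k m : ℕ) :
    charlierUnit x k m ^ 2 =
      x ^ m / m.factorial * charlier x k m ^ 2 / (x ^ k * k.factorial * Real.exp x) := by
  rw [charlierUnit, div_pow, mul_pow, Real.sq_sqrt (by positivity), Real.sq_sqrt (by positivity)]
  ring

theorem sum_charlierUnit_sq_le_one {x : ℝ} (hx : 0 < x) (k : ℕ) (s : Finset ℕ) :
    ∑ m ∈ s, charlierUnit x k m ^ 2 ≤ 1 := by
  simp only [charlierUnit_sq hx.le]
  rw [← Finset.sum_div, div_le_one (by positivity)]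
  exact sum_le_hasSum s (fun m _ => by positivity) (hasSum_charlier_sq hx.le k)

theorem abs_charlierUnit_le_one {x : ℝ} (hx : 0 < x) (k m : ℕ) : |charlierUnit x k m| ≤ 1 := by
  have h := sum_charlierUnit_sq_le_one hx k {m}
  rw [Finset.sum_singleton] at h
  exact (sq_le_one_iff_abs_le_one _).mp h

theorem charlierUnit_three_term {x : ℝ} (hx : 0 < x) (k m : ℕ) :
    √x * √(m + 2) * charlierUnit x k (m + 2) =
      (x + m + 1 - k) * charlierUnit x k (m + 1) - √x * √(m + 1) * charlierUnit x k m := by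
  have hstep : ∀ n : ℕ, √(n + 1 : ℝ) * √(x ^ (n + 1) / (n + 1).factorial) =
      √x * √(x ^ n / n.factorial) := by
    intro n
    rw [← Real.sqrt_mul (by positivity), ← Real.sqrt_mul hx.le, Nat.factorial_succ]
    congr 1
    push_cast
    field_simp
    ring
  have h1 := hstep (m + 1)
  have h0 := hstep m
  push_cast at h1
  rw [add_assoc (m : ℝ) 1 1, one_add_one_eq_two] at h1
  have hx2 : √x * √x = x := Real.mul_self_sqrt hx.le
  have hm2 : √(m + 1 : ℝ) * √(m + 1 : ℝ) = m + 1 := Real.mul_self_sqrt (by positivity)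
  have h3 := charlier_three_term x k m
  simp only [charlierUnit]
  have key : √x * √(m + 2) * (charlier x k (m + 2) * √(x ^ (m + 2) / (m + 2).factorial)) =
      (x + m + 1 - k) * (charlier x k (m + 1) * √(x ^ (m + 1) / (m + 1).factorial)) -
        √x * √(m + 1) * (charlier x k m * √(x ^ m / m.factorial)) := by
    linear_combination √x * charlier x k (m + 2) * h1
      + charlier x k (m + 2) * √(x ^ (m + 1) / (m + 1).factorial) * hx2
      + √(x ^ (m + 1) / (m + 1).factorial) * h3
      - √(m + 1 : ℝ) * charlier x k m * h0
      + charlier x k m * √(x ^ (m + 1) / (m + 1).factorial) * hm2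
  linear_combination key / √(x ^ k * k.factorial * Real.exp x)

theorem tendsto_charlierUnit_add {x : ℝ} (hx : 0 < x) (r : ℕ) :
    Tendsto (fun k : ℕ => charlierUnit x k (k + r + 2) + charlierUnit x k (k + r))
      atTop (nhds 0) := by
  have hlim : Tendsto (fun k : ℕ => (x + r + 1 + √x) / √x / √(k : ℝ)) atTop (nhds 0) :=
    (Real.tendsto_sqrt_atTop.comp tendsto_natCast_atTop_atTop).const_div_atTop _
  refine squeeze_zero_norm' ?_ hlim
  filter_upwards [eventually_gt_atTop 0] with k hk
  have hk' : (0 : ℝ) < k := by exact_mod_cast hk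
  have hsx : 0 < √x := Real.sqrt_pos.mpr hx
  have h := charlierUnit_three_term hx k (k + r)
  set A := charlierUnit x k (k + r + 2)
  set B := charlierUnit x k (k + r + 1)
  set C := charlierUnit x k (k + r)
  have hB : |B| ≤ 1 := abs_charlierUnit_le_one hx _ _
  have hC : |C| ≤ 1 := abs_charlierUnit_le_one hx _ _
  push_cast at h
  set s := √((k : ℝ) + r + 2)
  set t := √((k : ℝ) + r + 1)
  have hts : t ≤ s := Real.sqrt_le_sqrt (by linarith)
  have hst : s ≤ t + 1 := by
    rw [Real.sqrt_le_left (by positivity)]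
    have : t ^ 2 = (k : ℝ) + r + 1 := Real.sq_sqrt (by positivity)
    nlinarith [Real.sqrt_nonneg ((k : ℝ) + r + 1)]
  have hks : √(k : ℝ) ≤ s := Real.sqrt_le_sqrt (by linarith [(Nat.cast_nonneg r : (0 : ℝ) ≤ r)])
  have hkp : 0 < √(k : ℝ) := Real.sqrt_pos.mpr hk'
  rw [Real.norm_eq_abs, div_div, le_div_iff₀ (by positivity)]
  calc |A + C| * (√x * √(k : ℝ)) ≤ |A + C| * (√x * s) := by gcongr
    _ = |(A + C) * (√x * s)| := by rw [abs_mul, abs_of_pos (by positivity : 0 < √x * s)]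
    _ = |(x + r + 1) * B + √x * (s - t) * C| := by
        congr 1; linear_combination h
    _ ≤ |(x + r + 1) * B| + |√x * (s - t) * C| := abs_add_le _ _
    _ = (x + r + 1) * |B| + √x * (s - t) * |C| := by
        rw [abs_mul, abs_mul, abs_of_nonneg (by positivity : 0 ≤ x + r + 1),
          abs_of_nonneg (mul_nonneg hsx.le (sub_nonneg.mpr hts))]
    _ ≤ (x + r + 1) * 1 + √x * 1 * 1 := by
        gcongr
        linarith
    _ = x + r + 1 + √x := by ring

theorem tendsto_charlierUnit_sq_sub {x : ℝ} (hx : 0 < x) (r : ℕ) :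
    Tendsto (fun k : ℕ => charlierUnit x k (k + 2 * r) ^ 2 - charlierUnit x k k ^ 2)
      atTop (nhds 0) := by
  induction r with
  | zero => simp
  | succ r ih =>
    have hstep : Tendsto (fun k : ℕ =>
        (charlierUnit x k (k + 2 * r + 2) + charlierUnit x k (k + 2 * r)) *
          (charlierUnit x k (k + 2 * r + 2) - charlierUnit x k (k + 2 * r))) atTop (nhds 0) := by
      refine squeeze_zero_norm (fun k => ?_)
        (by simpa using (tendsto_charlierUnit_add hx (2 * r)).abs.mul_const 2)
      rw [norm_mul, Real.norm_eq_abs, Real.norm_eq_abs]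
      gcongr
      have h1 := abs_charlierUnit_le_one hx k (k + 2 * r + 2)
      have h2 := abs_charlierUnit_le_one hx k (k + 2 * r)
      exact (abs_sub _ _).trans (by linarith)
    have h := ih.add hstep
    rw [add_zero] at h
    refine h.congr fun k => ?_
    rw [show k + 2 * (r + 1) = k + 2 * r + 2 by ring]
    ring

theorem tendsto_charlierUnit_self_sq {x : ℝ} (hx : 0 < x) :
    Tendsto (fun k : ℕ => charlierUnit x k k ^ 2) atTop (nhds 0) := by
  rw [tendsto_order]
  refine ⟨fun a ha => Eventually.of_forall fun k => ha.trans_le (sq_nonneg _), fun ε hε => ?_⟩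
  obtain ⟨R, hR⟩ := exists_nat_gt (2 / ε)
  have hsum := tendsto_finsetSum (Finset.range R) fun r _ => tendsto_charlierUnit_sq_sub hx r
  rw [Finset.sum_const_zero] at hsum
  filter_upwards [hsum.eventually (lt_mem_nhds (show (-1 : ℝ) < 0 by norm_num))] with k hk
  have hle : ∑ r ∈ Finset.range R, charlierUnit x k (k + 2 * r) ^ 2 ≤ 1 := by
    have h := sum_charlierUnit_sq_le_one hx k ((Finset.range R).image fun r => k + 2 * r)
    rwa [Finset.sum_image fun a _ b _ hab => by simpa using hab] at h
  rw [Finset.sum_sub_distrib, Finset.sum_const, Finset.card_range, nsmul_eq_mul] at hk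
  rw [div_lt_iff₀ hε] at hR
  have hR0 : (0 : ℝ) ≤ R := Nat.cast_nonneg R
  by_contra! hcon
  nlinarith

theorem laguerreL_zero_mul_exp_sq {x : ℝ} (hx : 0 < x) (k : ℕ) :
    (laguerreL 0 k x * Real.exp (-x / 2)) ^ 2 = charlierUnit x k k ^ 2 := by
  have hs : ((-1 : ℝ) ^ k) ^ 2 = 1 := by rw [← pow_mul, mul_comm, pow_mul]; simp
  rw [charlierUnit_sq hx.le, laguerreL_zero_eq_charlier, mul_pow, div_pow, mul_pow, hs,
    ← Real.exp_nat_mul, show ((2 : ℕ) : ℝ) * (-x / 2) = -x by push_cast; ring, Real.exp_neg]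
  field_simp

theorem abs_laguerreL_zero_mul_exp_le_one {x : ℝ} (hx : 0 < x) (k : ℕ) :
    |laguerreL 0 k x * Real.exp (-x / 2)| ≤ 1 := by
  rw [(sq_eq_sq_iff_abs_eq_abs _ _).mp (laguerreL_zero_mul_exp_sq hx k)]
  exact abs_charlierUnit_le_one hx k k

theorem tendsto_laguerreL_zero_mul_exp {x : ℝ} (hx : 0 < x) :
    Tendsto (fun k : ℕ => laguerreL 0 k x * Real.exp (-x / 2)) atTop (nhds 0) := by
  have h := tendsto_charlierUnit_self_sq hx
  simp only [← laguerreL_zero_mul_exp_sq hx] at h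
  have h' := h.sqrt
  simp only [Real.sqrt_sq_eq_abs, Real.sqrt_zero] at h'
  exact (tendsto_zero_iff_abs_tendsto_zero _).mpr h'

theorem sum_realMultichoose (a : ℝ) (k : ℕ) :
    ∑ i ∈ Finset.range (k + 1), realMultichoose a (k - i) = realMultichoose (a + 1) k := by
  simpa using sum_realMultichoose_mul_choose a k 0

theorem laguerreR_mul_eq_sum {α : ℝ} (hα : 0 ≤ α) (k : ℕ) (x c : ℝ) :
    laguerreR α k x * c = ∑ i ∈ Finset.range (k + 1),
      realMultichoose α (k - i) / realMultichoose (α + 1) k * (laguerreL 0 i x * c) := by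
  rw [laguerreR, genBinom_self_eq_realMultichoose hα, laguerreL_eq_sum_laguerreL_zero hα,
    Finset.sum_div, Finset.sum_mul]
  exact Finset.sum_congr rfl fun i _ => by ring

theorem sum_realMultichoose_div {α : ℝ} (hα : 0 ≤ α) (k : ℕ) :
    ∑ i ∈ Finset.range (k + 1), realMultichoose α (k - i) / realMultichoose (α + 1) k = 1 := by
  rw [← Finset.sum_div, sum_realMultichoose,
    div_self (realMultichoose_pos (by linarith) k).ne']

theorem realMultichoose_div_nonneg {α : ℝ} (hα : 0 ≤ α) (n k : ℕ) :
    0 ≤ realMultichoose α n / realMultichoose (α + 1) k :=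
  div_nonneg (realMultichoose_nonneg hα n) (realMultichoose_nonneg (by linarith) k)

theorem tendsto_realMultichoose_div {α : ℝ} (hα : 0 ≤ α) (i : ℕ) :
    Tendsto (fun k : ℕ => realMultichoose α (k - i) / realMultichoose (α + 1) k)
      atTop (nhds 0) := by
  have hlim : Tendsto (fun k : ℕ => α / ((k - i : ℕ) : ℝ)) atTop (nhds 0) :=
    (tendsto_natCast_atTop_atTop.comp (tendsto_sub_atTop_nat i)).const_div_atTop α
  refine squeeze_zero' (Eventually.of_forall fun k => realMultichoose_div_nonneg hα _ _) ?_ hlim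
  filter_upwards [eventually_gt_atTop i] with k hk
  have hn : (0 : ℝ) < (k - i : ℕ) := by exact_mod_cast Nat.sub_pos_of_lt hk
  have hmono : realMultichoose (α + 1) (k - i) ≤ realMultichoose (α + 1) k :=
    realMultichoose_mono hα (Nat.sub_le k i)
  rw [div_le_div_iff₀ (realMultichoose_pos (by linarith) k) hn]
  calc realMultichoose α (k - i) * (k - i : ℕ)
      ≤ (α + (k - i : ℕ)) * realMultichoose α (k - i) := by
        nlinarith [realMultichoose_nonneg hα (k - i)]
    _ = α * realMultichoose (α + 1) (k - i) := add_mul_realMultichoose _ _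
    _ ≤ α * realMultichoose (α + 1) k := by gcongr

/-- Szegő's bound for normalized Laguerre polynomials of nonnegative order. -/
theorem abs_laguerreR_mul_exp_le_one {α x : ℝ} (hα : 0 ≤ α) (hx : 0 < x) (k : ℕ) :
    |laguerreR α k x * Real.exp (-x / 2)| ≤ 1 := by
  rw [laguerreR_mul_eq_sum hα]
  refine (Finset.abs_sum_le_sum_abs _ _).trans
    ((Finset.sum_le_sum fun i _ => ?_).trans_eq (sum_realMultichoose_div hα k))
  rw [abs_mul, abs_of_nonneg (realMultichoose_div_nonneg hα _ _)]
  exact mul_le_of_le_one_right (realMultichoose_div_nonneg hα _ _)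
    (abs_laguerreL_zero_mul_exp_le_one hx i)

theorem tendsto_laguerreR_mul_exp {α x : ℝ} (hα : 0 ≤ α) (hx : 0 < x) :
    Tendsto (fun k : ℕ => laguerreR α k x * Real.exp (-x / 2)) atTop (nhds 0) := by
  rw [Metric.tendsto_atTop']
  intro ε hε
  obtain ⟨N, hN⟩ := (Metric.tendsto_atTop.mp (tendsto_laguerreL_zero_mul_exp hx)) (ε / 2)
    (by positivity)
  have hsum := tendsto_finsetSum (Finset.range N) fun i _ => tendsto_realMultichoose_div hα i
  rw [Finset.sum_const_zero] at hsum
  obtain ⟨K, hK⟩ := eventually_atTop.mp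
    (hsum.eventually (gt_mem_nhds (show 0 < ε / 2 by positivity)))
  refine ⟨max N K, fun k hk => ?_⟩
  have hkN : N ≤ k + 1 := by have := le_max_left N K; omega
  have hkK := hK k ((le_max_right N K).trans hk.le)
  rw [dist_zero_right, Real.norm_eq_abs, laguerreR_mul_eq_sum hα]
  set p : ℕ → ℝ := fun i => realMultichoose α (k - i) / realMultichoose (α + 1) k
  have hp : ∀ i, 0 ≤ p i := fun i => realMultichoose_div_nonneg hα _ _
  calc |∑ i ∈ Finset.range (k + 1), p i * (laguerreL 0 i x * Real.exp (-x / 2))|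
      ≤ ∑ i ∈ Finset.range (k + 1), |p i * (laguerreL 0 i x * Real.exp (-x / 2))| :=
        Finset.abs_sum_le_sum_abs _ _
    _ ≤ ∑ i ∈ Finset.range (k + 1), ((if i < N then p i else 0) + p i * (ε / 2)) := by
        refine Finset.sum_le_sum fun i _ => ?_
        rw [abs_mul, abs_of_nonneg (hp i)]
        split_ifs with hi
        · have := mul_le_of_le_one_right (hp i) (abs_laguerreL_zero_mul_exp_le_one hx i)
          have := mul_nonneg (hp i) (half_pos hε).le
          linarith
        · rw [zero_add]
          have h := (hN i (not_lt.mp hi)).le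
          rw [dist_zero_right, Real.norm_eq_abs] at h
          exact mul_le_mul_of_nonneg_left h (hp i)
    _ = ∑ i ∈ Finset.range N, p i + ε / 2 := by
        rw [Finset.sum_add_distrib, ← Finset.sum_mul, sum_realMultichoose_div hα, one_mul,
          ← Finset.sum_filter]
        congr 2
        ext i
        simp only [Finset.mem_filter, Finset.mem_range]
        omega
    _ < ε := by linarith

theorem continuous_laguerreR (α : ℝ) (k : ℕ) : Continuous (laguerreR α k) := by
  unfold laguerreR laguerreL
  fun_prop

/-- **Riemann–Lebesgue Lemma for Laguerre expansions.** For `α ≥ 0` and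
`f ∈ L_{w(α)}`, the Fourier–Laguerre coefficients
`f̂_α(k) = ∫_0^∞ f(x) R_k^α(x) x^α e^{-x} dx` exist (the integrals converge
absolutely) and tend to `0` as `k → ∞`. -/
theorem riemann_lebesgue_laguerre (α : ℝ) (hα : 0 ≤ α) (f : ℝ → ℝ)
    (hf : MemLaguerreL α f) :
    (∀ k : ℕ, IntegrableOn
        (fun x => f x * laguerreR α k x * x ^ α * Real.exp (-x)) (Ioi 0)) ∧
    Tendsto (fun k : ℕ =>
        ∫ x in Ioi (0 : ℝ), f x * laguerreR α k x * x ^ α * Real.exp (-x))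
      atTop (nhds 0) := by
  have hfac : ∀ (k : ℕ) (x : ℝ), f x * laguerreR α k x * x ^ α * Real.exp (-x) =
      (laguerreR α k x * Real.exp (-x / 2)) * (f x * Real.exp (-x / 2) * x ^ α) := by
    intro k x
    have h : Real.exp (-x) = Real.exp (-x / 2) * Real.exp (-x / 2) := by
      rw [← Real.exp_add, add_halves]
    rw [h]
    ring
  simp only [hfac]
  have hmeas : ∀ k : ℕ, AEStronglyMeasurable
      (fun x => laguerreR α k x * Real.exp (-x / 2)) (volume.restrict (Ioi 0)) := fun k => by
    have := continuous_laguerreR α k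
    exact Continuous.aestronglyMeasurable (by fun_prop)
  have hbound : ∀ k : ℕ, ∀ᵐ x ∂volume.restrict (Ioi (0 : ℝ)),
      ‖laguerreR α k x * Real.exp (-x / 2)‖ ≤ 1 := fun k =>
    (ae_restrict_mem measurableSet_Ioi).mono fun x hx => abs_laguerreR_mul_exp_le_one hα hx k
  have hint : ∀ k : ℕ, IntegrableOn (fun x => (laguerreR α k x * Real.exp (-x / 2)) *
      (f x * Real.exp (-x / 2) * x ^ α)) (Ioi 0) := fun k =>
    Integrable.bdd_mul hf (hmeas k) (hbound k)
  refine ⟨hint, ?_⟩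
  have hae : ∀ᵐ x ∂volume.restrict (Ioi (0 : ℝ)), Tendsto (fun k : ℕ =>
      (laguerreR α k x * Real.exp (-x / 2)) * (f x * Real.exp (-x / 2) * x ^ α))
      atTop (nhds 0) := by
    filter_upwards [ae_restrict_mem measurableSet_Ioi] with x hx
    simpa using (tendsto_laguerreR_mul_exp hα hx).mul_const (f x * Real.exp (-x / 2) * x ^ α)
  have hlim := tendsto_integral_of_dominated_convergence
    (fun x => ‖f x * Real.exp (-x / 2) * x ^ α‖) (fun k => (hint k).aestronglyMeasurable)
    hf.norm (fun k => by
      filter_upwards [hbound k] with x hx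
      rw [norm_mul]
      exact mul_le_of_le_one_left (norm_nonneg _) hx) hae
  simpa only [integral_zero] using hlim
end

section
/- Let α, β be real numbers with α ≥ β > -1 and α ≥ -1/2, and let 0 ≤ a < b ≤ π. Let χ be the characteristic function of the interval [a, b]. Then the Fourier–Jacobi coefficients of χ tend to zero: lim_{k→∞} χ̂_{(α,β)}(k) = 0. -/
open MeasureTheory Filter Set

noncomputable section

/-- The Jacobi polynomial `P_k^{(α,β)}(x)`. -/
def jacobiP (α β : ℝ) (k : ℕ) (x : ℝ) : ℝ :=
  ∑ s ∈ Finset.range (k + 1),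
    genBinom ((k : ℝ) + α) (k - s) * genBinom ((k : ℝ) + β) s *
      ((x - 1) / 2) ^ s * ((x + 1) / 2) ^ (k - s)

/-- The normalized Jacobi polynomial `R_k^{(α,β)}(x) = P_k^{(α,β)}(x)/P_k^{(α,β)}(1)`. -/
def jacobiR (α β : ℝ) (k : ℕ) (x : ℝ) : ℝ := jacobiP α β k x / jacobiP α β k 1

/-- The Jacobi weight `(sin(θ/2))^{2α+1} (cos(θ/2))^{2β+1}`. -/
def jacobiWeight (α β : ℝ) (θ : ℝ) : ℝ :=
  Real.sin (θ / 2) ^ (2 * α + 1) * Real.cos (θ / 2) ^ (2 * β + 1)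

/-- `f ∈ L_{(α,β)}`: `f` is integrable on `[0,π]` against the Jacobi weight. -/
def MemJacobiL (α β : ℝ) (f : ℝ → ℝ) : Prop :=
  IntegrableOn (fun θ => f θ * jacobiWeight α β θ) (Ioc 0 Real.pi)

/-- The norm `‖f‖_{L_{(α,β)}}`. -/
def jacobiNorm (α β : ℝ) (f : ℝ → ℝ) : ℝ :=
  ∫ θ in Ioc (0 : ℝ) Real.pi, |f θ| * jacobiWeight α β θ

/-- The `k`-th Fourier–Jacobi coefficient `f̂_{(α,β)}(k)`. -/
def fourierJacobi (α β : ℝ) (f : ℝ → ℝ) (k : ℕ) : ℝ :=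
  ∫ θ in Ioc (0 : ℝ) Real.pi, f θ * jacobiR α β k (Real.cos θ) * jacobiWeight α β θ

end

/-- The monomial `((x - 1) / 2) ^ s * ((x + 1) / 2) ^ t`. -/
private noncomputable def jacobiMonomial (s t : ℕ) (x : ℝ) : ℝ := ((x - 1) / 2) ^ s * ((x + 1) / 2) ^ t

private lemma hasDerivAt_jacobiMonomial (s t : ℕ) {x : ℝ} (h1 : x - 1 ≠ 0) (h2 : x + 1 ≠ 0) :
    HasDerivAt (jacobiMonomial s t) (jacobiMonomial s t x * (s / (x - 1) + t / (x + 1))) x := by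
  have hu : HasDerivAt (fun y : ℝ => (y - 1) / 2) (1 / 2) x :=
    ((hasDerivAt_id x).sub_const 1).div_const 2
  have hv : HasDerivAt (fun y : ℝ => (y + 1) / 2) (1 / 2) x :=
    ((hasDerivAt_id x).add_const 1).div_const 2
  refine ((hu.pow s).mul (hv.pow t)).congr_deriv ?_
  unfold jacobiMonomial
  cases s <;> cases t <;> simp <;> field_simp <;> ring

private lemma hasDerivAt_deriv_jacobiMonomial (s t : ℕ) {x : ℝ} (h1 : x - 1 ≠ 0)
    (h2 : x + 1 ≠ 0) :
    HasDerivAt (fun x => jacobiMonomial s t x * (s / (x - 1) + t / (x + 1)))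
      (jacobiMonomial s t x *
        ((s / (x - 1) + t / (x + 1)) ^ 2 - s / (x - 1) ^ 2 - t / (x + 1) ^ 2)) x := by
  have hu : HasDerivAt (fun y : ℝ => (s : ℝ) / (y - 1)) (-s / (x - 1) ^ 2) x := by
    refine ((hasDerivAt_const x (s : ℝ)).div ((hasDerivAt_id x).sub_const 1) h1).congr_deriv ?_
    simp
  have hv : HasDerivAt (fun y : ℝ => (t : ℝ) / (y + 1)) (-t / (x + 1) ^ 2) x := by
    refine ((hasDerivAt_const x (t : ℝ)).div ((hasDerivAt_id x).add_const 1) h2).congr_deriv ?_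
    simp
  refine ((hasDerivAt_jacobiMonomial s t h1 h2).mul (hu.add hv)).congr_deriv ?_
  simp only [Pi.add_apply]
  ring

/-- The coefficient of the `s`-th monomial in `jacobiP α β k`. -/
private noncomputable def jacobiCoeff (α β : ℝ) (k s : ℕ) : ℝ :=
  genBinom ((k : ℝ) + α) (k - s) * genBinom ((k : ℝ) + β) s

private lemma jacobiCoeff_succ {α β : ℝ} (hα : -1 < α) (hβ : -1 < β) {k s : ℕ} (hs : s < k) :
    ((s : ℝ) + 1) * (s + 1 + α) * jacobiCoeff α β k (s + 1) =
      ((k : ℝ) - s) * (k - s + β) * jacobiCoeff α β k s := by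
  obtain ⟨m, rfl⟩ : ∃ m, k = s + 1 + m := ⟨k - (s + 1), by omega⟩
  have e1 : s + 1 + m - (s + 1) = m := by omega
  have e2 : s + 1 + m - s = m + 1 := by omega
  have hs0 : (0 : ℝ) ≤ s := s.cast_nonneg
  have hm0 : (0 : ℝ) ≤ m := m.cast_nonneg
  have p1 : (0 : ℝ) < s + 1 := by linarith
  have p2 : (0 : ℝ) < m + 1 := by linarith
  have p3 : (0 : ℝ) < s + α + 1 := by linarith
  have p4 : (0 : ℝ) < m + β + 1 := by linarith
  have g1 := Real.Gamma_add_one p1.ne'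
  have g2 := Real.Gamma_add_one p2.ne'
  have g3 := Real.Gamma_add_one p3.ne'
  have g4 := Real.Gamma_add_one p4.ne'
  have q1 := (Real.Gamma_pos_of_pos p1).ne'
  have q2 := (Real.Gamma_pos_of_pos p2).ne'
  have q3 := (Real.Gamma_pos_of_pos p3).ne'
  have q4 := (Real.Gamma_pos_of_pos p4).ne'
  unfold jacobiCoeff genBinom
  rw [e1, e2]
  push_cast
  rw [show (s : ℝ) + 1 + m + α - m + 1 = s + α + 1 + 1 by ring,
    show (s : ℝ) + 1 + m + α - (m + 1) + 1 = s + α + 1 by ring,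
    show (s : ℝ) + 1 + m + β - s + 1 = m + β + 1 + 1 by ring,
    show (s : ℝ) + 1 + m + β - (s + 1) + 1 = m + β + 1 by ring, g1, g2, g3, g4]
  field_simp
  ring

private lemma jacobiP_eq_sum (α β : ℝ) (k : ℕ) : jacobiP α β k =
    fun x => ∑ s ∈ Finset.range (k + 1), jacobiCoeff α β k s * jacobiMonomial s (k - s) x := by
  funext x
  simp only [jacobiP, jacobiCoeff, jacobiMonomial, mul_assoc]

private lemma contDiff_jacobiP (α β : ℝ) (k : ℕ) : ContDiff ℝ 2 (jacobiP α β k) := by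
  unfold jacobiP
  fun_prop

private lemma deriv_jacobiP (α β : ℝ) (k : ℕ) {x : ℝ} (h1 : x - 1 ≠ 0) (h2 : x + 1 ≠ 0) :
    deriv (jacobiP α β k) x = ∑ s ∈ Finset.range (k + 1), jacobiCoeff α β k s *
      (jacobiMonomial s (k - s) x * (s / (x - 1) + (k - s : ℕ) / (x + 1))) := by
  rw [jacobiP_eq_sum]
  exact (HasDerivAt.fun_sum fun s _ =>
    (hasDerivAt_jacobiMonomial s (k - s) h1 h2).const_mul _).deriv

private lemma deriv_deriv_jacobiP (α β : ℝ) (k : ℕ) {x : ℝ} (h1 : x - 1 ≠ 0) (h2 : x + 1 ≠ 0) :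
    deriv (deriv (jacobiP α β k)) x = ∑ s ∈ Finset.range (k + 1), jacobiCoeff α β k s *
      (jacobiMonomial s (k - s) x * ((s / (x - 1) + (k - s : ℕ) / (x + 1)) ^ 2
        - s / (x - 1) ^ 2 - (k - s : ℕ) / (x + 1) ^ 2)) := by
  have hev : deriv (jacobiP α β k) =ᶠ[nhds x] fun x => ∑ s ∈ Finset.range (k + 1),
      jacobiCoeff α β k s *
        (jacobiMonomial s (k - s) x * (s / (x - 1) + (k - s : ℕ) / (x + 1))) := by
    have c1 : ∀ᶠ y in nhds x, y - 1 ≠ 0 :=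
      (continuous_id.sub continuous_const).continuousAt.eventually_ne h1
    have c2 : ∀ᶠ y in nhds x, y + 1 ≠ 0 :=
      (continuous_id.add continuous_const).continuousAt.eventually_ne h2
    filter_upwards [c1, c2] with y hy1 hy2 using deriv_jacobiP α β k hy1 hy2
  rw [hev.deriv_eq]
  exact (HasDerivAt.fun_sum fun s _ =>
    (hasDerivAt_deriv_jacobiMonomial s (k - s) h1 h2).const_mul _).deriv

/-- The Jacobi differential equation. -/
private lemma jacobiP_ode {α β : ℝ} (hα : -1 < α) (hβ : -1 < β) (k : ℕ) {x : ℝ}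
    (hx : x ∈ Ioo (-1 : ℝ) 1) :
    (1 - x ^ 2) * deriv (deriv (jacobiP α β k)) x
      + (β - α - (α + β + 2) * x) * deriv (jacobiP α β k) x
      + k * (k + α + β + 1) * jacobiP α β k x = 0 := by
  have h1 : x - 1 ≠ 0 := by linarith [hx.2]
  have h2 : x + 1 ≠ 0 := by linarith [hx.1]
  rw [deriv_deriv_jacobiP α β k h1 h2, deriv_jacobiP α β k h1 h2, jacobiP_eq_sum]
  simp only [Finset.mul_sum]
  rw [← Finset.sum_add_distrib, ← Finset.sum_add_distrib]
  set E : ℕ → ℝ := fun s => if s ≤ k then s * (s + α) * (jacobiCoeff α β k s *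
    jacobiMonomial s (k - s) x) * (1 - (x + 1) / (x - 1)) else 0 with hE
  have key : ∀ s ∈ Finset.range (k + 1),
      (1 - x ^ 2) * (jacobiCoeff α β k s * (jacobiMonomial s (k - s) x *
        ((s / (x - 1) + (k - s : ℕ) / (x + 1)) ^ 2 - s / (x - 1) ^ 2
          - (k - s : ℕ) / (x + 1) ^ 2)))
      + (β - α - (α + β + 2) * x) * (jacobiCoeff α β k s * (jacobiMonomial s (k - s) x *
        (s / (x - 1) + (k - s : ℕ) / (x + 1))))
      + k * (k + α + β + 1) * (jacobiCoeff α β k s * jacobiMonomial s (k - s) x)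
      = E s - E (s + 1) := by
    intro s hs
    have hsk : s ≤ k := Nat.lt_succ_iff.mp (Finset.mem_range.mp hs)
    have hnext : E (s + 1) = ((k : ℝ) - s) * (k - s + β) * (jacobiCoeff α β k s *
        jacobiMonomial s (k - s) x) * ((x - 1) / (x + 1) - 1) := by
      rcases hsk.lt_or_eq with hlt | rfl
      · have hm : jacobiMonomial (s + 1) (k - (s + 1)) x =
            jacobiMonomial s (k - s) x * ((x - 1) / (x + 1)) := by
          rw [show k - s = k - (s + 1) + 1 by omega]
          unfold jacobiMonomial
          field_simp
          ring
        simp only [hE, if_pos (Nat.succ_le_of_lt hlt)]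
        rw [hm]
        push_cast
        rw [show ((s : ℝ) + 1) * (s + 1 + α) * (jacobiCoeff α β k (s + 1) *
          (jacobiMonomial s (k - s) x * ((x - 1) / (x + 1)))) =
          (((s : ℝ) + 1) * (s + 1 + α) * jacobiCoeff α β k (s + 1)) *
          (jacobiMonomial s (k - s) x * ((x - 1) / (x + 1))) by ring,
          jacobiCoeff_succ hα hβ hlt]
        field_simp
      · simp [hE]
    rw [hnext]
    simp only [hE, if_pos hsk, Nat.cast_sub hsk]
    generalize jacobiCoeff α β k s = c
    generalize jacobiMonomial s (k - s) x = m
    field_simp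
    ring
  rw [Finset.sum_congr rfl key, Finset.sum_range_sub']
  simp [hE]

private lemma jacobiR_eq (α β : ℝ) (k : ℕ) :
    jacobiR α β k = fun x => jacobiP α β k x / jacobiP α β k 1 := rfl

private lemma contDiff_jacobiR (α β : ℝ) (k : ℕ) : ContDiff ℝ 2 (jacobiR α β k) :=
  (contDiff_jacobiP α β k).div_const _

private lemma hasDerivAt_jacobiR (α β : ℝ) (k : ℕ) (x : ℝ) :
    HasDerivAt (jacobiR α β k) (deriv (jacobiR α β k) x) x :=
  ((contDiff_jacobiR α β k).differentiable (by norm_num) x).hasDerivAt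

private lemma hasDerivAt_deriv_jacobiR (α β : ℝ) (k : ℕ) (x : ℝ) :
    HasDerivAt (deriv (jacobiR α β k)) (deriv (deriv (jacobiR α β k)) x) x := by
  have h : ContDiff ℝ (1 + 1) (jacobiR α β k) := contDiff_jacobiR α β k
  exact ((contDiff_succ_iff_deriv.mp h).2.2.differentiable (by norm_num) x).hasDerivAt

private lemma jacobiR_ode {α β : ℝ} (hα : -1 < α) (hβ : -1 < β) (k : ℕ) {x : ℝ}
    (hx : x ∈ Ioo (-1 : ℝ) 1) :
    (1 - x ^ 2) * deriv (deriv (jacobiR α β k)) x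
      + (β - α - (α + β + 2) * x) * deriv (jacobiR α β k) x
      + k * (k + α + β + 1) * jacobiR α β k x = 0 := by
  have h1 : deriv (jacobiR α β k) = fun x => deriv (jacobiP α β k) x / jacobiP α β k 1 := by
    funext y
    rw [jacobiR_eq, deriv_div_const]
  rw [h1, deriv_div_const, jacobiR_eq]
  have h := jacobiP_ode hα hβ k hx
  linear_combination (jacobiP α β k 1)⁻¹ * h

/-- A bound for the derivative at a fixed point, from the monotonicity properties of
`λ R ^ 2 + (1 - t ^ 2) R' ^ 2` on `[x, 1]`. -/
private lemma sq_deriv_jacobiR_le {α β : ℝ} (hα : -(1 / 2) ≤ α) (hβ : -1 < β) {k : ℕ}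
    (hk : 1 ≤ k) {x : ℝ} (hx : x ∈ Ioo (-1 : ℝ) 1) :
    (1 - x ^ 2) * deriv (jacobiR α β k) x ^ 2 ≤
      Real.exp (2 * |α + β + 1| / (1 + x) * (1 - x)) * (k * (k + α + β + 1)) := by
  set C : ℝ := 2 * |α + β + 1| / (1 + x) with hC
  set l : ℝ := k * (k + α + β + 1) with hl
  have hk' : (1 : ℝ) ≤ k := by exact_mod_cast hk
  have hl0 : 0 ≤ l := mul_nonneg (by linarith) (by linarith)
  have hx1 : 0 < 1 + x := by linarith [hx.1]
  have hC0 : 0 ≤ C := by positivity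
  set F : ℝ → ℝ := fun t => l * jacobiR α β k t ^ 2 + (1 - t ^ 2) * deriv (jacobiR α β k) t ^ 2
    with hF
  have hFd (t : ℝ) : HasDerivAt F (l * (2 * jacobiR α β k t * deriv (jacobiR α β k) t)
      + (-(2 * t) * deriv (jacobiR α β k) t ^ 2 + (1 - t ^ 2) *
        (2 * deriv (jacobiR α β k) t * deriv (deriv (jacobiR α β k)) t))) t := by
    refine ((((hasDerivAt_jacobiR α β k t).pow 2).const_mul l).add
      ((((hasDerivAt_id t).pow 2).const_sub 1).mul
        ((hasDerivAt_deriv_jacobiR α β k t).pow 2))).congr_deriv ?_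
    simp
  have hGd (t : ℝ) := ((((hasDerivAt_id t).const_mul C).exp).mul (hFd t))
  have hmono : MonotoneOn (fun t => Real.exp (C * t) * F t) (Icc x 1) := by
    refine monotoneOn_of_deriv_nonneg (convex_Icc x 1)
      (fun t _ => (hGd t).continuousAt.continuousWithinAt)
      (fun t _ => (hGd t).differentiableAt.differentiableWithinAt) fun t ht => ?_
    rw [interior_Icc] at ht
    have ht' : t ∈ Ioo (-1 : ℝ) 1 := ⟨hx.1.trans ht.1, ht.2⟩
    have hd : deriv (fun t => Real.exp (C * t) * F t) t = _ := (hGd t).deriv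
    rw [hd]
    have hode := jacobiR_ode (show -1 < α by linarith) hβ k ht'
    rw [← hl] at hode
    have hcoef : 0 ≤ C * (1 - t ^ 2) + 2 * (α - β + (α + β + 1) * t) := by
      have h1 : 2 * |α + β + 1| * (1 - t) ≤ C * (1 - t ^ 2) := by
        rw [hC, div_mul_eq_mul_div, le_div_iff₀ hx1]
        have : 0 ≤ 2 * |α + β + 1| * (1 - t) :=
          mul_nonneg (by positivity) (by linarith [ht.2])
        nlinarith [mul_nonneg this (sub_nonneg.2 ht.1.le)]
      have h2 : (α + β + 1) * (1 - t) ≤ |α + β + 1| * (1 - t) :=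
        mul_le_mul_of_nonneg_right (le_abs_self _) (by linarith [ht.2])
      linarith
    have hsum : Real.exp (C * t) * (C * (l * jacobiR α β k t ^ 2) +
        (C * (1 - t ^ 2) + 2 * (α - β + (α + β + 1) * t)) * deriv (jacobiR α β k) t ^ 2) ≥ 0 := by
      positivity
    refine hsum.le.trans_eq ?_
    simp only [hF, id, mul_one]
    linear_combination -(2 * Real.exp (C * t) * deriv (jacobiR α β k) t) * hode
  have hle := hmono (left_mem_Icc.2 hx.2.le) (right_mem_Icc.2 hx.2.le) hx.2.le
  have hR1 : jacobiR α β k 1 ^ 2 ≤ 1 := by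
    by_cases h : jacobiP α β k 1 = 0 <;> simp [jacobiR, h]
  have hF1 : F 1 ≤ l := by
    simp only [hF]
    nlinarith
  have hxF : F x ≤ Real.exp (C * (1 - x)) * l := by
    have e : Real.exp (C * 1) = Real.exp (C * x) * Real.exp (C * (1 - x)) := by
      rw [← Real.exp_add]
      ring_nf
    simp only [e, mul_assoc] at hle
    exact (le_of_mul_le_mul_left hle (Real.exp_pos _)).trans
      (mul_le_mul_of_nonneg_left hF1 (Real.exp_pos _).le)
  refine le_trans ?_ hxF
  simp only [hF]
  have : 0 ≤ l * jacobiR α β k x ^ 2 := by positivity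
  linarith

/-- The primitive of `R_k w`, up to the factor `k (k + α + β + 1) / 2`. -/
private noncomputable def jacobiFlux (α β : ℝ) (k : ℕ) (θ : ℝ) : ℝ :=
  Real.sin (θ / 2) ^ (2 * α + 2) * Real.cos (θ / 2) ^ (2 * β + 2) *
    deriv (jacobiR α β k) (Real.cos θ)

private lemma sin_half_pos {θ : ℝ} (hθ : θ ∈ Ioo 0 Real.pi) : 0 < Real.sin (θ / 2) :=
  Real.sin_pos_of_pos_of_lt_pi (by linarith [hθ.1]) (by linarith [hθ.1, hθ.2])

private lemma cos_half_pos {θ : ℝ} (hθ : θ ∈ Ioo 0 Real.pi) : 0 < Real.cos (θ / 2) :=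
  Real.cos_pos_of_mem_Ioo ⟨by linarith [hθ.1, hθ.2], by linarith [hθ.2]⟩

private lemma cos_mem_Ioo {θ : ℝ} (hθ : θ ∈ Ioo 0 Real.pi) : Real.cos θ ∈ Ioo (-1 : ℝ) 1 := by
  have h := Real.sin_pos_of_mem_Ioo hθ
  constructor <;> nlinarith [Real.sin_sq_add_cos_sq θ, Real.cos_le_one θ, Real.neg_one_le_cos θ]

private lemma hasDerivAt_sin_half (θ : ℝ) :
    HasDerivAt (fun θ => Real.sin (θ / 2)) (Real.cos (θ / 2) / 2) θ := by
  refine (((hasDerivAt_id θ).div_const 2).sin).congr_deriv ?_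
  simp only [id]
  ring

private lemma hasDerivAt_cos_half (θ : ℝ) :
    HasDerivAt (fun θ => Real.cos (θ / 2)) (-Real.sin (θ / 2) / 2) θ := by
  refine (((hasDerivAt_id θ).div_const 2).cos).congr_deriv ?_
  simp only [id]
  ring

private lemma hasDerivAt_jacobiFlux {α β : ℝ} (hα : -1 < α) (hβ : -1 < β) (k : ℕ) {θ : ℝ}
    (hθ : θ ∈ Ioo 0 Real.pi) :
    HasDerivAt (jacobiFlux α β k) (k * (k + α + β + 1) / 2 *
      (jacobiR α β k (Real.cos θ) * jacobiWeight α β θ)) θ := by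
  have hs := sin_half_pos hθ
  have hc := cos_half_pos hθ
  have hode := jacobiR_ode hα hβ k (cos_mem_Ioo hθ)
  have d1 := (hasDerivAt_sin_half θ).rpow_const (p := 2 * α + 2) (Or.inl hs.ne')
  have d2 := (hasDerivAt_cos_half θ).rpow_const (p := 2 * β + 2) (Or.inl hc.ne')
  have d3 := (hasDerivAt_deriv_jacobiR α β k (Real.cos θ)).comp θ (Real.hasDerivAt_cos θ)
  refine ((d1.mul d2).mul d3).congr_deriv ?_
  have r1 : Real.sin (θ / 2) ^ (2 * α + 2) =
      Real.sin (θ / 2) ^ (2 * α + 1) * Real.sin (θ / 2) := by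
    rw [← Real.rpow_add_one hs.ne']
    ring_nf
  have r2 : Real.cos (θ / 2) ^ (2 * β + 2) =
      Real.cos (θ / 2) ^ (2 * β + 1) * Real.cos (θ / 2) := by
    rw [← Real.rpow_add_one hc.ne']
    ring_nf
  have t1 : Real.sin θ = 2 * Real.sin (θ / 2) * Real.cos (θ / 2) := by
    rw [← Real.sin_two_mul]
    ring_nf
  have t2 : Real.cos (θ / 2) ^ 2 = (1 + Real.cos θ) / 2 := by
    rw [Real.cos_sq]
    ring_nf
  have t3 : Real.sin (θ / 2) ^ 2 = (1 - Real.cos θ) / 2 := by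
    rw [Real.sin_sq, t2]
    ring
  simp only [Function.comp, Pi.mul_apply, show 2 * α + 2 - 1 = 2 * α + 1 by ring,
    show 2 * β + 2 - 1 = 2 * β + 1 by ring, r1, r2, t1, jacobiWeight]
  generalize Real.sin (θ / 2) ^ (2 * α + 1) = A at *
  generalize Real.cos (θ / 2) ^ (2 * β + 1) = B at *
  generalize Real.sin (θ / 2) = S at *
  generalize Real.cos (θ / 2) = c at *
  generalize deriv (deriv (jacobiR α β k)) (Real.cos θ) = y2 at *
  generalize deriv (jacobiR α β k) (Real.cos θ) = y1 at *
  have t4 : S ^ 2 * c ^ 2 = (1 - Real.cos θ) / 2 * ((1 + Real.cos θ) / 2) := by rw [t2, t3]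
  linear_combination (A * B * y1 * (α + 1)) * t2 - (A * B * y1 * (β + 1)) * t3
    - 2 * A * B * y2 * t4 - A * B / 2 * hode

private lemma continuous_jacobiFlux {α β : ℝ} (hα : -1 < α) (hβ : -1 < β) (k : ℕ) :
    Continuous (jacobiFlux α β k) := by
  have h1 : Continuous fun θ : ℝ => Real.sin (θ / 2) := by fun_prop
  have h2 : Continuous fun θ : ℝ => Real.cos (θ / 2) := by fun_prop
  have h3 : Continuous (deriv (jacobiR α β k)) :=
    continuous_iff_continuousAt.2 fun x => (hasDerivAt_deriv_jacobiR α β k x).continuousAt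
  exact ((h1.rpow_const fun _ => Or.inr (by linarith)).mul
    (h2.rpow_const fun _ => Or.inr (by linarith))).mul (h3.comp Real.continuous_cos)

private lemma integrableOn_jacobiWeight {α β : ℝ} (hα : -(1 / 2) ≤ α) (hβ : -1 < β) :
    IntegrableOn (jacobiWeight α β) (Icc 0 Real.pi) := by
  have h1 : Continuous fun θ : ℝ => Real.sin (θ / 2) := by fun_prop
  have h2 : Continuous fun θ : ℝ => Real.cos (θ / 2) := by fun_prop
  have hS : Continuous fun θ : ℝ => Real.sin (θ / 2) ^ (2 * α + 1) :=
    h1.rpow_const fun _ => Or.inr (by linarith)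
  have hprim : IntegrableOn
      (fun θ : ℝ => (β + 1) * (Real.sin (θ / 2) * Real.cos (θ / 2) ^ (2 * β + 1)))
      (Ioc 0 Real.pi) := by
    refine intervalIntegral.integrableOn_deriv_of_nonneg
      (g := fun θ : ℝ => -(Real.cos (θ / 2) ^ (2 * β + 2)))
      ((h2.rpow_const fun _ => Or.inr (by linarith)).neg.continuousOn) (fun θ hθ => ?_)
      (fun θ hθ => ?_)
    · refine (((hasDerivAt_cos_half θ).rpow_const (p := 2 * β + 2)
        (Or.inl (cos_half_pos hθ).ne')).neg).congr_deriv ?_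
      rw [show 2 * β + 2 - 1 = 2 * β + 1 by ring]
      ring
    · have := sin_half_pos hθ
      have := cos_half_pos hθ
      have : 0 < β + 1 := by linarith
      positivity
  have hsc : IntegrableOn (fun θ : ℝ => Real.sin (θ / 2) * Real.cos (θ / 2) ^ (2 * β + 1))
      (Icc 0 Real.pi) := by
    rw [integrableOn_Icc_iff_integrableOn_Ioc]
    refine (hprim.const_mul (β + 1)⁻¹).congr (Eventually.of_forall fun θ => ?_)
    have : β + 1 ≠ 0 := by linarith
    field_simp
  have hA := hsc.continuousOn_mul (hS.mul h1).continuousOn isCompact_Icc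
  have hB : IntegrableOn (fun θ : ℝ => Real.sin (θ / 2) ^ (2 * α + 1) *
      Real.cos (θ / 2) ^ (2 * β + 3)) (Icc 0 Real.pi) :=
    (hS.mul (h2.rpow_const fun _ => Or.inr (by linarith))).continuousOn.integrableOn_Icc
  have hAB := hA.add hB
  rw [integrableOn_Icc_iff_integrableOn_Ioo] at hAB ⊢
  refine hAB.congr_fun (fun θ hθ => ?_) measurableSet_Ioo
  have hc := cos_half_pos hθ
  have r : Real.cos (θ / 2) ^ (2 * β + 3) =
      Real.cos (θ / 2) ^ (2 * β + 1) * Real.cos (θ / 2) ^ 2 := by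
    rw [← Real.rpow_natCast, ← Real.rpow_add hc]
    norm_num
    ring_nf
  simp only [Pi.add_apply, Pi.mul_apply, jacobiWeight, r]
  linear_combination Real.sin (θ / 2) ^ (2 * α + 1) * Real.cos (θ / 2) ^ (2 * β + 1) *
    Real.sin_sq_add_cos_sq (θ / 2)

private lemma fourierJacobi_indicator {α β : ℝ} (hα : -(1 / 2) ≤ α) (hβ : -1 < β) {a b : ℝ}
    (ha : 0 ≤ a) (hab : a ≤ b) (hb : b ≤ Real.pi) (k : ℕ) :
    k * (k + α + β + 1) / 2 * fourierJacobi α β ((Icc a b).indicator fun _ => (1 : ℝ)) k =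
      jacobiFlux α β k b - jacobiFlux α β k a := by
  have hα' : -1 < α := by linarith
  have hsub : Icc a b ⊆ Icc 0 Real.pi := Icc_subset_Icc ha hb
  have hint : IntegrableOn (fun θ => k * (k + α + β + 1) / 2 *
      (jacobiR α β k (Real.cos θ) * jacobiWeight α β θ)) (Icc a b) :=
    (((integrableOn_jacobiWeight hα hβ).continuousOn_mul
      ((contDiff_jacobiR α β k).continuous.comp Real.continuous_cos).continuousOn
      isCompact_Icc).mono_set hsub).const_mul _
  have hftc := intervalIntegral.integral_eq_sub_of_hasDerivAt_of_le hab
    (continuous_jacobiFlux hα' hβ k).continuousOn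
    (fun θ hθ => hasDerivAt_jacobiFlux hα' hβ k ⟨ha.trans_lt hθ.1, hθ.2.trans_le hb⟩)
    ((intervalIntegrable_iff_integrableOn_Icc_of_le hab).2 hint)
  rw [← hftc, intervalIntegral.integral_of_le hab, integral_const_mul, fourierJacobi,
    ← integral_Icc_eq_integral_Ioc, ← integral_Icc_eq_integral_Ioc]
  congr 1
  have hi : (fun θ => (Icc a b).indicator (fun _ => (1 : ℝ)) θ * jacobiR α β k (Real.cos θ) *
      jacobiWeight α β θ) =
      (Icc a b).indicator fun θ => jacobiR α β k (Real.cos θ) * jacobiWeight α β θ := by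
    funext θ
    by_cases h : θ ∈ Icc a b <;> simp [h]
  rw [hi, setIntegral_indicator measurableSet_Icc, inter_eq_right.2 hsub]

private lemma exists_abs_jacobiFlux_le {α β : ℝ} (hα : -(1 / 2) ≤ α) (hβ : -1 < β) {θ : ℝ}
    (hθ : θ ∈ Icc 0 Real.pi) :
    ∃ K : ℝ, ∀ k : ℕ, 1 ≤ k → |jacobiFlux α β k θ| ≤ K * √(k * (k + α + β + 1)) := by
  rcases hθ.1.eq_or_lt with rfl | h0
  · refine ⟨0, fun k _ => ?_⟩
    simp [jacobiFlux, Real.zero_rpow (show 2 * α + 2 ≠ 0 by linarith)]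
  rcases hθ.2.eq_or_lt with rfl | hpi
  · refine ⟨0, fun k _ => ?_⟩
    simp [jacobiFlux, Real.zero_rpow (show 2 * β + 2 ≠ 0 by linarith)]
  have hx := cos_mem_Ioo ⟨h0, hpi⟩
  have hx2 : 0 < 1 - Real.cos θ ^ 2 := by nlinarith [hx.1, hx.2]
  set x := Real.cos θ with hxdef
  refine ⟨|Real.sin (θ / 2) ^ (2 * α + 2) * Real.cos (θ / 2) ^ (2 * β + 2)| *
    √(Real.exp (2 * |α + β + 1| / (1 + x) * (1 - x)) / (1 - x ^ 2)), fun k hk => ?_⟩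
  have h := sq_deriv_jacobiR_le hα hβ hk hx
  rw [jacobiFlux, abs_mul, mul_assoc, ← Real.sqrt_mul (by positivity)]
  refine mul_le_mul_of_nonneg_left (Real.abs_le_sqrt ?_) (abs_nonneg _)
  rw [div_mul_eq_mul_div, le_div_iff₀ hx2]
  linarith

/-- For `α ≥ β > -1`, `α ≥ -1/2` and `0 ≤ a < b ≤ π`, the Fourier–Jacobi
coefficients of the characteristic function of `[a, b]` tend to zero. -/
theorem jacobi_coeff_indicator_tendsto_zero (α β : ℝ) (hβα : β ≤ α) (hβ : -1 < β)
    (hα : -(1/2) ≤ α) (a b : ℝ) (ha : 0 ≤ a) (hab : a < b) (hb : b ≤ Real.pi) :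
    Tendsto (fun k : ℕ =>
        fourierJacobi α β ((Icc a b).indicator fun _ => (1 : ℝ)) k)
      atTop (nhds 0) := by
  obtain ⟨K₁, h₁⟩ := exists_abs_jacobiFlux_le hα hβ ⟨ha, hab.le.trans hb⟩
  obtain ⟨K₂, h₂⟩ := exists_abs_jacobiFlux_le hα hβ ⟨ha.trans hab.le, hb⟩
  have hcast : Tendsto (fun k : ℕ => (k : ℝ)) atTop atTop := tendsto_natCast_atTop_atTop
  have hl : Tendsto (fun k : ℕ => √((k : ℝ) * (k + α + β + 1))) atTop atTop := by
    refine Real.tendsto_sqrt_atTop.comp (hcast.atTop_mul_atTop₀ ?_)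
    simpa only [add_assoc] using tendsto_atTop_add_const_right atTop (α + (β + 1)) hcast
  refine squeeze_zero_norm' ?_ (hl.const_div_atTop (2 * (K₁ + K₂)))
  filter_upwards [eventually_ge_atTop 1] with k hk
  have hk' : (1 : ℝ) ≤ k := by exact_mod_cast hk
  have hlam : 0 < (k : ℝ) * (k + α + β + 1) := mul_pos (by linarith) (by linarith)
  have hco := fourierJacobi_indicator hα hβ ha hab.le hb k
  have hbd : |jacobiFlux α β k b - jacobiFlux α β k a| ≤
      (K₁ + K₂) * √((k : ℝ) * (k + α + β + 1)) := by
    linarith [abs_sub (jacobiFlux α β k b) (jacobiFlux α β k a), h₁ k hk, h₂ k hk]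
  rw [← hco, abs_mul, abs_of_pos (half_pos hlam)] at hbd
  have hr := Real.sqrt_pos.2 hlam
  rw [Real.norm_eq_abs, le_div_iff₀ hr]
  nth_rewrite 1 [← Real.mul_self_sqrt hlam.le] at hbd
  refine le_of_mul_le_mul_left ?_ hr
  linarith
end
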